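/- Let (X,μ) be a σ-finite Lebesgue space with μ(X)=∞ and let T be an ergodic invertible measure-preserving transformation of X of rank one. Assume the weak closure of the powers of T is polynomial, in the following sense: for every sequence of integers n_k and every function L on pairs of finite-measure sets, if μ(T^{n_k}A ∩ B) → L(A,B) for all measurable A,B of finite measure, then there exist nonnegative reals c_s (s∈ℤ) with Σ_s c_s ≤ 1 such that L(A,B) = Σ_{s∈ℤ} c_s · μ(T^sA ∩ B) for all such A,B. Then T has minimal self-joinings: every ergodic self-joining ν of T equals Δ^n for some n∈ℤ. -/

import Mathlib

open MeasureTheory Filter Topology Set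
open scoped ENNReal NNReal symmDiff

/-- `T` has rank one with respect to `μ`. -/
def IsRankOne {X : Type*} [MeasurableSpace X] (μ : Measure X) (T : Equiv.Perm X) : Prop :=
  ∃ (E : ℕ → Set X) (h : ℕ → ℕ),
    (∀ j, MeasurableSet (E j)) ∧
    (∀ j, ∀ i i' : ℕ, i ≤ h j → i' ≤ h j → i ≠ i' →
      Disjoint ((⇑(T ^ (i : ℤ))) '' E j) ((⇑(T ^ (i' : ℤ))) '' E j)) ∧
    (∀ A : Set X, MeasurableSet A → μ A < ∞ → ∀ ε : ℝ≥0∞, 0 < ε →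
      ∀ᶠ j in atTop, ∃ I : Finset ℕ, (∀ i ∈ I, i ≤ h j) ∧
        μ (symmDiff A (⋃ i ∈ I, (⇑(T ^ (i : ℤ))) '' E j)) < ε)

/-- `ν` is a self-joining of `T`. -/
def IsSelfJoining {X : Type*} [MeasurableSpace X] (μ : Measure X) (T : Equiv.Perm X)
    (ν : Measure (X × X)) : Prop :=
  Measure.map (Prod.map ⇑T ⇑T) ν = ν ∧
  ∀ A : Set X, MeasurableSet A → μ A < ∞ →
    ν (A ×ˢ (Set.univ : Set X)) = μ A ∧ ν ((Set.univ : Set X) ×ˢ A) = μ A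

theorem image_zpow_image_zpow {X : Type*} {T : Equiv.Perm X} (a b : ℤ) (A : Set X) :
    ⇑(T ^ a) '' (⇑(T ^ b) '' A) = ⇑(T ^ (a + b)) '' A := by
  rw [zpow_add, Equiv.Perm.coe_mul, image_comp]

section Graph

variable {X : Type*} [MeasurableSpace X] {μ : Measure X} {T : Equiv.Perm X}

theorem measurePreserving_zpow (hTm : Measurable ⇑T.symm) (hT : MeasurePreserving ⇑T μ μ) (k : ℤ) :
    MeasurePreserving ⇑(T ^ k) μ μ := by
  have hs : MeasurePreserving ⇑T.symm μ μ :=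
    MeasurePreserving.symm (⟨T, hT.measurable, hTm⟩ : X ≃ᵐ X) hT
  have hpow : ∀ (S : Equiv.Perm X), MeasurePreserving ⇑S μ μ → ∀ n : ℕ,
      MeasurePreserving ⇑(S ^ n) μ μ := by
    intro S hS n
    rw [Equiv.Perm.coe_pow]
    exact hS.iterate n
  obtain ⟨n, rfl | rfl⟩ := k.eq_nat_or_neg
  · simpa using hpow T hT n
  · simpa [← inv_pow] using hpow T⁻¹ hs n

theorem measurableSet_image_zpow (hTm : Measurable ⇑T.symm) (hT : MeasurePreserving ⇑T μ μ)
    (k : ℤ) {A : Set X} (hA : MeasurableSet A) : MeasurableSet (⇑(T ^ k) '' A) := by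
  have h : ⇑(T ^ k) '' A = ⇑(T ^ (-k)) ⁻¹' A := by
    rw [Equiv.image_eq_preimage_symm, zpow_neg]; rfl
  rw [h]
  exact (measurePreserving_zpow hTm hT (-k)).measurable hA

theorem measure_image_zpow (hTm : Measurable ⇑T.symm) (hT : MeasurePreserving ⇑T μ μ)
    (k : ℤ) {A : Set X} (hA : MeasurableSet A) : μ (⇑(T ^ k) '' A) = μ A := by
  rw [← (measurePreserving_zpow hTm hT k).measure_preimage
    (measurableSet_image_zpow hTm hT k hA).nullMeasurableSet, (T ^ k).preimage_image]

/-- The graph measure of `T ^ k`. -/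
noncomputable def graphMeasure (μ : Measure X) (T : Equiv.Perm X) (k : ℤ) : Measure (X × X) :=
  μ.map fun x => (x, (T ^ k) x)

theorem measurable_graph (hTm : Measurable ⇑T.symm) (hT : MeasurePreserving ⇑T μ μ) (k : ℤ) :
    Measurable fun x => (x, (T ^ k) x) :=
  measurable_id.prodMk (measurePreserving_zpow hTm hT k).measurable

theorem graphMeasure_prod (hTm : Measurable ⇑T.symm) (hT : MeasurePreserving ⇑T μ μ) (k : ℤ)
    {A B : Set X} (hA : MeasurableSet A) (hB : MeasurableSet B) :
    graphMeasure μ T k (A ×ˢ B) = μ (⇑(T ^ k) '' A ∩ B) := by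
  rw [graphMeasure, Measure.map_apply (measurable_graph hTm hT k) (hA.prod hB),
    ← (measurePreserving_zpow hTm hT k).measure_preimage
      ((measurableSet_image_zpow hTm hT k hA).inter hB).nullMeasurableSet, preimage_inter,
    (T ^ k).preimage_image]
  rfl

/-- Both marginals of `ρ` are equal to `μ`. -/
def HasMarginals (μ : Measure X) (ρ : Measure (X × X)) : Prop :=
  ∀ A : Set X, MeasurableSet A → ρ (A ×ˢ univ) = μ A ∧ ρ (univ ×ˢ A) = μ A

theorem hasMarginals_graphMeasure (hTm : Measurable ⇑T.symm) (hT : MeasurePreserving ⇑T μ μ)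
    (k : ℤ) : HasMarginals μ (graphMeasure μ T k) := by
  intro A hA
  rw [graphMeasure_prod hTm hT k hA .univ, graphMeasure_prod hTm hT k .univ hA]
  simp [measure_image_zpow hTm hT k hA]

theorem IsSelfJoining.hasMarginals [SigmaFinite μ] {ν : Measure (X × X)}
    (hν : IsSelfJoining μ T ν) : HasMarginals μ ν := by
  intro A hA
  have hmono : Monotone fun n => A ∩ spanningSets μ n :=
    fun m n h => inter_subset_inter_right _ (monotone_spanningSets μ h)
  have hA' : A = ⋃ n, A ∩ spanningSets μ n := by
    rw [← inter_iUnion, iUnion_spanningSets, inter_univ]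
  have hfin n := hν.2 (A ∩ spanningSets μ n) (hA.inter (measurableSet_spanningSets μ n))
    ((measure_mono inter_subset_right).trans_lt (measure_spanningSets_lt_top μ n))
  rw [hA', iUnion_prod_const, prod_iUnion, hmono.measure_iUnion,
    Monotone.measure_iUnion (fun m n h => prod_mono_left (hmono h)),
    Monotone.measure_iUnion (fun m n h => prod_mono_right (hmono h))]
  exact ⟨iSup_congr fun n => (hfin n).1, iSup_congr fun n => (hfin n).2⟩

theorem HasMarginals.prod_le {ρ : Measure (X × X)} (hρ : HasMarginals μ ρ) {A A' B B' : Set X}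
    (hA : MeasurableSet A) (hA' : MeasurableSet A') (hB : MeasurableSet B)
    (hB' : MeasurableSet B') :
    ρ (A ×ˢ B) ≤ ρ (A' ×ˢ B') + (μ (symmDiff A A') + μ (symmDiff B B')) := by
  rw [← (hρ _ (hA.symmDiff hA')).1, ← (hρ _ (hB.symmDiff hB')).2]
  refine (measure_mono ?_).trans ((measure_union_le (A' ×ˢ B') _).trans
    (add_le_add_right (measure_union_le _ _) _))
  rintro ⟨x, y⟩ ⟨hx, hy⟩
  simp only [mem_union, mem_prod, mem_univ, and_true, true_and, mem_symmDiff]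
  dsimp only at hx hy
  tauto

theorem measure_image_prod_image {ν : Measure (X × X)} (hTm : Measurable ⇑T.symm)
    (hT : MeasurePreserving ⇑T μ μ) (hν : Measure.map (Prod.map ⇑T ⇑T) ν = ν) (n : ℕ)
    {A B : Set X} (hA : MeasurableSet A) (hB : MeasurableSet B) :
    ν ((⇑(T ^ (n : ℤ)) '' A) ×ˢ (⇑(T ^ (n : ℤ)) '' B)) = ν (A ×ˢ B) := by
  have hmp : MeasurePreserving (Prod.map ⇑T ⇑T) ν ν :=
    ⟨hT.measurable.prodMap hT.measurable, hν⟩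
  have h := (hmp.iterate n).measure_preimage ((measurableSet_image_zpow hTm hT n hA).prod
    (measurableSet_image_zpow hTm hT n hB)).nullMeasurableSet
  rw [Prod.map_iterate, ← Equiv.Perm.coe_pow, ← zpow_natCast,
    Set.preimage_prod_map_prod] at h
  rw [← h, (T ^ (n : ℤ)).preimage_image, (T ^ (n : ℤ)).preimage_image]

end Graph

section Tower

variable {X : Type*} [MeasurableSpace X] {μ : Measure X} {T : Equiv.Perm X}

/-- The union of the levels of the tower over `E` with indices in `I`. -/
def levelUnion (T : Equiv.Perm X) (E : Set X) (I : Finset ℕ) : Set X :=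
  ⋃ i ∈ I, (⇑(T ^ (i : ℤ))) '' E

theorem measurableSet_levelUnion (hTm : Measurable ⇑T.symm) (hT : MeasurePreserving ⇑T μ μ)
    {E : Set X} (hE : MeasurableSet E) (I : Finset ℕ) : MeasurableSet (levelUnion T E I) :=
  I.measurableSet_biUnion fun i _ => measurableSet_image_zpow hTm hT i hE

variable {E : Set X} {h : ℕ}

theorem card_mul_measure_le (hTm : Measurable ⇑T.symm) (hT : MeasurePreserving ⇑T μ μ)
    (hE : MeasurableSet E)
    (hdisj : ∀ i i' : ℕ, i ≤ h → i' ≤ h → i ≠ i' →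
      Disjoint ((⇑(T ^ (i : ℤ))) '' E) ((⇑(T ^ (i' : ℤ))) '' E))
    {I J : Finset ℕ} (hJ : ∀ i ∈ J, i ≤ h) (k : ℤ) :
    (((I ×ˢ J).filter fun p => (p.2 : ℤ) - p.1 = k).card : ℝ≥0∞) * μ E ≤
      graphMeasure μ T k (levelUnion T E I ×ˢ levelUnion T E J) := by
  rw [graphMeasure_prod hTm hT k (measurableSet_levelUnion hTm hT hE I)
    (measurableSet_levelUnion hTm hT hE J), ← nsmul_eq_mul, ← Finset.sum_const,
    ← Finset.sum_congr rfl (fun (p : ℕ × ℕ) _ => measure_image_zpow hTm hT p.2 hE),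
    ← measure_biUnion_finset _ fun p _ => measurableSet_image_zpow hTm hT p.2 hE]
  · refine measure_mono (iUnion₂_subset fun p hp => ?_)
    simp only [Finset.mem_filter, Finset.mem_product] at hp
    refine subset_inter ?_ (subset_biUnion_of_mem (u := fun i : ℕ => ⇑(T ^ (i : ℤ)) '' E) hp.1.2)
    have : (p.2 : ℤ) = k + p.1 := by omega
    rw [this, ← image_zpow_image_zpow]
    exact image_mono (subset_biUnion_of_mem (u := fun i : ℕ => ⇑(T ^ (i : ℤ)) '' E) hp.1.1)
  · intro p hp q hq hpq
    simp only [Finset.coe_filter, mem_ofPred_eq, Finset.mem_product] at hp hq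
    refine hdisj _ _ (hJ _ hp.1.2) (hJ _ hq.1.2) fun h => hpq ?_
    ext <;> omega

theorem sum_measure_prod_level_le {ν : Measure (X × X)} (hTm : Measurable ⇑T.symm)
    (hT : MeasurePreserving ⇑T μ μ) (hν : Measure.map (Prod.map ⇑T ⇑T) ν = ν)
    (hm : HasMarginals μ ν) (hE : MeasurableSet E)
    (hdisj : ∀ i i' : ℕ, i ≤ h → i' ≤ h → i ≠ i' →
      Disjoint ((⇑(T ^ (i : ℤ))) '' E) ((⇑(T ^ (i' : ℤ))) '' E)) :
    ∑ k ∈ Finset.Icc (-(h : ℤ)) h, ν (E ×ˢ (⇑(T ^ k) '' E)) ≤ 2 * μ E := by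
  have hsub : Finset.Icc (-(h : ℤ)) h ⊆
      (Finset.range (h + 1)).image (fun i : ℕ => (i : ℤ)) ∪
        (Finset.range (h + 1)).image (fun i : ℕ => -(i : ℤ)) := by
    intro k hk
    simp only [Finset.mem_Icc, Finset.mem_union, Finset.mem_image, Finset.mem_range] at hk ⊢
    rcases le_total 0 k with hk0 | hk0
    · exact .inl ⟨k.toNat, by omega, by omega⟩
    · exact .inr ⟨(-k).toNat, by omega, by omega⟩
  have hmeas (i : ℕ) := measurableSet_image_zpow hTm hT i hE
  have hpair {i i' : ℕ} (hi : i ∈ Finset.range (h + 1)) (hi' : i' ∈ Finset.range (h + 1))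
      (hii' : i ≠ i') := hdisj i i' (by simpa [Nat.lt_succ_iff] using hi)
        (by simpa [Nat.lt_succ_iff] using hi') hii'
  have h1 : ∑ k ∈ (Finset.range (h + 1)).image (fun i : ℕ => (i : ℤ)),
      ν (E ×ˢ (⇑(T ^ k) '' E)) ≤ μ E := by
    rw [Finset.sum_image (by intro a _ b _ hab; simpa using hab),
      ← measure_biUnion_finset (f := fun i : ℕ => E ×ˢ (⇑(T ^ (i : ℤ)) '' E)) _
        fun i _ => hE.prod (hmeas i), ← (hm E hE).1]
    · exact measure_mono (iUnion₂_subset fun i _ => prod_mono_right (subset_univ _))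
    · intro i hi i' hi' hii'
      exact (hpair hi hi' hii').set_prod_right _ _
  have h2 : ∑ k ∈ (Finset.range (h + 1)).image (fun i : ℕ => -(i : ℤ)),
      ν (E ×ˢ (⇑(T ^ k) '' E)) ≤ μ E := by
    have hflip (i : ℕ) : ν (E ×ˢ (⇑(T ^ (-(i : ℤ))) '' E)) = ν ((⇑(T ^ (i : ℤ)) '' E) ×ˢ E) := by
      rw [← measure_image_prod_image hTm hT hν i hE (measurableSet_image_zpow hTm hT _ hE),
        image_zpow_image_zpow]
      simp
    rw [Finset.sum_image (by intro a _ b _ hab; simpa using hab),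
      Finset.sum_congr rfl fun i _ => hflip i,
      ← measure_biUnion_finset (f := fun i : ℕ => (⇑(T ^ (i : ℤ)) '' E) ×ˢ E) _
        fun i _ => (hmeas i).prod hE, ← (hm E hE).2]
    · exact measure_mono (iUnion₂_subset fun i _ => prod_mono_left (subset_univ _))
    · intro i hi i' hi' hii'
      exact (hpair hi hi' hii').set_prod_left _ _
  refine (Finset.sum_le_sum_of_subset hsub).trans ?_
  rw [two_mul]
  refine le_trans ?_ (add_le_add h1 h2)
  rw [← Finset.sum_union_inter]
  exact le_self_add

theorem measure_levelUnion_prod_le {ν : Measure (X × X)} (hTm : Measurable ⇑T.symm)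
    (hT : MeasurePreserving ⇑T μ μ) (hν : Measure.map (Prod.map ⇑T ⇑T) ν = ν)
    (hE : MeasurableSet E) {I J : Finset ℕ} (hI : ∀ i ∈ I, i ≤ h) (hJ : ∀ i ∈ J, i ≤ h) :
    ν (levelUnion T E I ×ˢ levelUnion T E J) ≤
      ∑ k ∈ Finset.Icc (-(h : ℤ)) h, ν (E ×ˢ (⇑(T ^ k) '' E)) *
        (((I ×ˢ J).filter fun p => (p.2 : ℤ) - p.1 = k).card : ℝ≥0∞) := by
  have hcover : levelUnion T E I ×ˢ levelUnion T E J ⊆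
      ⋃ p ∈ I ×ˢ J, (⇑(T ^ (p.1 : ℤ)) '' E) ×ˢ (⇑(T ^ (p.2 : ℤ)) '' E) := by
    rintro ⟨x, y⟩ ⟨hx, hy⟩
    simp only [levelUnion, mem_iUnion, exists_prop] at hx hy ⊢
    obtain ⟨i, hi, hx⟩ := hx
    obtain ⟨j, hj, hy⟩ := hy
    exact ⟨(i, j), by simp [hi, hj], hx, hy⟩
  have hval (p : ℕ × ℕ) : ν ((⇑(T ^ (p.1 : ℤ)) '' E) ×ˢ (⇑(T ^ (p.2 : ℤ)) '' E)) =
      ν (E ×ˢ (⇑(T ^ ((p.2 : ℤ) - p.1)) '' E)) := by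
    rw [← measure_image_prod_image hTm hT hν p.1 hE (measurableSet_image_zpow hTm hT _ hE),
      image_zpow_image_zpow]
    simp
  refine (measure_mono hcover).trans ((measure_biUnion_finset_le _ _).trans ?_)
  rw [Finset.sum_congr rfl fun p _ => hval p,
    ← Finset.sum_fiberwise_of_maps_to (g := fun p : ℕ × ℕ => (p.2 : ℤ) - p.1)
      (t := Finset.Icc (-(h : ℤ)) h)]
  · refine Finset.sum_le_sum fun k _ => ?_
    rw [Finset.sum_congr rfl (g := fun _ => ν (E ×ˢ (⇑(T ^ k) '' E))), Finset.sum_const,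
      nsmul_eq_mul, mul_comm]
    intro p hp
    rw [(Finset.mem_filter.1 hp).2]
  · intro p hp
    have h1 := hI _ (Finset.mem_product.1 hp).1
    have h2 := hJ _ (Finset.mem_product.1 hp).2
    simp only [Finset.mem_Icc]
    omega

theorem sum_levelUnion_prod_le {ν : Measure (X × X)} (hTm : Measurable ⇑T.symm)
    (hT : MeasurePreserving ⇑T μ μ) (hν : Measure.map (Prod.map ⇑T ⇑T) ν = ν)
    (hm : HasMarginals μ ν) (hE : MeasurableSet E)
    (hdisj : ∀ i i' : ℕ, i ≤ h → i' ≤ h → i ≠ i' →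
      Disjoint ((⇑(T ^ (i : ℤ))) '' E) ((⇑(T ^ (i' : ℤ))) '' E))
    {ι : Type*} [Fintype ι] {I J : ι → Finset ℕ} (hI : ∀ r, ∀ i ∈ I r, i ≤ h)
    (hJ : ∀ r, ∀ i ∈ J r, i ≤ h) {M : ℝ≥0∞} (hM0 : M ≠ 0) (hMtop : M ≠ ∞)
    (hM : ∀ k, ∑ r, graphMeasure μ T k (levelUnion T E (I r) ×ˢ levelUnion T E (J r)) ≤ M) :
    ∑ r, ν (levelUnion T E (I r) ×ˢ levelUnion T E (J r)) ≤ 2 * M := by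
  refine (Finset.sum_le_sum fun r _ =>
    measure_levelUnion_prod_le hTm hT hν hE (hI r) (hJ r)).trans ?_
  rw [Finset.sum_comm]
  calc
    _ ≤ ∑ k ∈ Finset.Icc (-(h : ℤ)) h, ν (E ×ˢ (⇑(T ^ k) '' E)) * (M / μ E) := by
      refine Finset.sum_le_sum fun k _ => ?_
      rw [← Finset.mul_sum]
      gcongr
      rw [ENNReal.le_div_iff_mul_le (.inr hM0) (.inr hMtop), Finset.sum_mul]
      exact (Finset.sum_le_sum fun r _ => card_mul_measure_le hTm hT hE hdisj (hJ r) k).trans (hM k)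
    _ ≤ 2 * μ E * (M / μ E) := by
      rw [← Finset.sum_mul]
      gcongr
      exact sum_measure_prod_level_le hTm hT hν hm hE hdisj
    _ ≤ 2 * M := by
      rw [mul_assoc]
      gcongr
      exact ENNReal.mul_div_le

end Tower

section Domination

variable {X : Type*} [MeasurableSpace X] {μ : Measure X} {T : Equiv.Perm X}

/-- `F` splits into finitely many measurable
rectangles whose sides have finite measure. -/
def IsRectangular (μ : Measure X) (F : Set (X × X)) : Prop :=
  ∃ (ι : Type) (_ : Fintype ι) (A B : ι → Set X),
    (∀ r, MeasurableSet (A r) ∧ MeasurableSet (B r) ∧ μ (A r) < ∞ ∧ μ (B r) < ∞) ∧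
    ∀ ρ : Measure (X × X), ρ F = ∑ r, ρ (A r ×ˢ B r)

theorem IsSelfJoining.le_two_mul [SigmaFinite μ] (hTm : Measurable ⇑T.symm)
    (hT : MeasurePreserving ⇑T μ μ) (hrk : IsRankOne μ T) {ν : Measure (X × X)}
    (hν : IsSelfJoining μ T ν) {F : Set (X × X)} (hF : IsRectangular μ F) {M : ℝ≥0}
    (hM : ∀ k, graphMeasure μ T k F ≤ M) : ν F ≤ 2 * M := by
  obtain ⟨ι, _, A, B, hAB, hsum⟩ := hF
  obtain ⟨E, h, hE, hdisj, happ⟩ := hrk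
  have hm := hν.hasMarginals
  have key : ∀ ε : ℝ≥0, 0 < ε →
      ν F ≤ 2 * (M + (Fintype.card ι * (ε + ε) + ε)) + Fintype.card ι * (ε + ε) := by
    intro ε hε
    have hε' : (0 : ℝ≥0∞) < ε := by exact_mod_cast hε
    have hA := eventually_all.2 fun r => happ (A r) (hAB r).1 (hAB r).2.2.1 ε hε'
    have hB := eventually_all.2 fun r => happ (B r) (hAB r).2.1 (hAB r).2.2.2 ε hε'
    obtain ⟨j, hA, hB⟩ := (hA.and hB).exists
    choose I hI hIA using hA
    choose J hJ hJB using hB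
    have hmI r := measurableSet_levelUnion hTm hT (hE j) (I r)
    have hmJ r := measurableSet_levelUnion hTm hT (hE j) (J r)
    rw [hsum]
    calc
      _ ≤ ∑ r, (ν (levelUnion T (E j) (I r) ×ˢ levelUnion T (E j) (J r)) + (ε + ε)) := by
        refine Finset.sum_le_sum fun r _ => (hm.prod_le (hAB r).1 (hmI r) (hAB r).2.1
          (hmJ r)).trans ?_
        gcongr
        exacts [(hIA r).le, (hJB r).le]
      _ = ∑ r, ν (levelUnion T (E j) (I r) ×ˢ levelUnion T (E j) (J r)) +
          Fintype.card ι * (ε + ε) := by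
        simp [Finset.sum_add_distrib, mul_add]
      _ ≤ _ := by
        gcongr
        refine sum_levelUnion_prod_le hTm hT hν.1 hm (hE j) (hdisj j) hI hJ ?_ ?_ fun k => ?_
        · simp [hε.ne']
        · finiteness
        · calc
            _ ≤ ∑ r, (graphMeasure μ T k (A r ×ˢ B r) + (ε + ε)) := by
              refine Finset.sum_le_sum fun r _ => ((hasMarginals_graphMeasure hTm hT k).prod_le
                (hmI r) (hAB r).1 (hmJ r) (hAB r).2.1).trans ?_
              rw [symmDiff_comm, symmDiff_comm _ (B r)]
              gcongr
              exacts [(hIA r).le, (hJB r).le]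
            _ = graphMeasure μ T k F + Fintype.card ι * (ε + ε) := by
              simp [Finset.sum_add_distrib, hsum, mul_add]
            _ ≤ _ := add_le_add (hM k) le_self_add
  have hlim : Tendsto (fun ε : ℝ≥0 => (2 * (M + (Fintype.card ι * (ε + ε) + ε)) +
      Fintype.card ι * (ε + ε) : ℝ≥0)) (𝓝[>] 0) (𝓝 (2 * M)) := by
    refine Tendsto.mono_left ?_ nhdsWithin_le_nhds
    refine Continuous.tendsto' (by fun_prop) _ _ (by simp)
  have hlim' := ENNReal.tendsto_coe.2 hlim
  push_cast at hlim'
  refine ge_of_tendsto hlim' ?_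
  filter_upwards [self_mem_nhdsWithin] with ε hε
  exact key ε hε

end Domination

section Compactness

variable {X : Type*} [MeasurableSpace X] {μ : Measure X} {T : Equiv.Perm X}

theorem ENNReal.exists_tendsto_of_forall_approx {f : ℕ → ℝ≥0∞}
    (hf : ∀ ε : ℝ≥0, 0 < ε → ∃ (g : ℕ → ℝ≥0∞) (a : ℝ≥0∞), Tendsto g atTop (𝓝 a) ∧ a ≠ ∞ ∧
      ∀ k, f k ≤ g k + ε ∧ g k ≤ f k + ε) : ∃ a, Tendsto f atTop (𝓝 a) := by
  refine ⟨_, tendsto_of_le_liminf_of_limsup_le le_rfl ?_⟩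
  refine ENNReal.le_of_forall_pos_le_add fun ε hε _ => ?_
  obtain ⟨g, a, hg, ha, hfg⟩ := hf (ε / 4) (by positivity)
  have hε4 : ((ε / 4 : ℝ≥0) : ℝ≥0∞) ≠ 0 := by
    simpa using hε.ne'
  have hev := (ENNReal.tendsto_nhds ha).1 hg _ (pos_iff_ne_zero.2 hε4)
  have h1 : limsup f atTop ≤ a + (ε / 4 : ℝ≥0) + (ε / 4 : ℝ≥0) := by
    refine limsup_le_of_le (by isBoundedDefault) (hev.mono fun k hk => ?_)
    exact (hfg k).1.trans (add_le_add_left hk.2 _)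
  have h2 : a - (ε / 4 : ℝ≥0) - (ε / 4 : ℝ≥0) ≤ liminf f atTop := by
    refine le_liminf_of_le (by isBoundedDefault) (hev.mono fun k hk => ?_)
    rw [tsub_le_iff_right]
    exact hk.1.trans (hfg k).2
  rw [tsub_le_iff_right, tsub_le_iff_right] at h2
  refine h1.trans ?_
  calc
    _ ≤ liminf f atTop + (ε / 4 : ℝ≥0) + (ε / 4 : ℝ≥0) + (ε / 4 : ℝ≥0) + (ε / 4 : ℝ≥0) := by
      gcongr
    _ = _ := by
      simp only [add_assoc, ← ENNReal.coe_add]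
      congr 2
      ext; push_cast; ring

theorem IsRankOne.exists_subseq_tendsto (hTm : Measurable ⇑T.symm)
    (hT : MeasurePreserving ⇑T μ μ) (hrk : IsRankOne μ T) (κ : ℕ → ℤ) :
    ∃ φ : ℕ → ℕ, StrictMono φ ∧ ∀ A B : Set X, MeasurableSet A → MeasurableSet B →
      μ A < ∞ → μ B < ∞ →
      ∃ a, Tendsto (fun j => graphMeasure μ T (κ (φ j)) (A ×ˢ B)) atTop (𝓝 a) := by
  obtain ⟨E, h, hE, hdisj, happ⟩ := hrk
  let u : ℕ → (ℕ × Finset ℕ) × (ℕ × Finset ℕ) → ℝ≥0∞ := fun n p =>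
    graphMeasure μ T (κ n) (levelUnion T (E p.1.1) p.1.2 ×ˢ levelUnion T (E p.2.1) p.2.2)
  obtain ⟨b, φ, hφ, hb⟩ := CompactSpace.tendsto_subseq u
  rw [tendsto_pi_nhds] at hb
  refine ⟨φ, hφ, fun A B hA hB hAf hBf => ENNReal.exists_tendsto_of_forall_approx fun ε hε => ?_⟩
  have hε' : (0 : ℝ≥0∞) < (ε / 2 : ℝ≥0) := by
    exact_mod_cast half_pos hε
  obtain ⟨i, I, hI, hIA⟩ := (happ A hA hAf _ hε').exists
  obtain ⟨j, J, hJ, hJB⟩ := (happ B hB hBf _ hε').exists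
  have hmI := measurableSet_levelUnion hTm hT (hE i) I
  have hmJ := measurableSet_levelUnion hTm hT (hE j) J
  have herr : μ (symmDiff A (levelUnion T (E i) I)) + μ (symmDiff B (levelUnion T (E j) J)) ≤ ε := by
    refine (add_le_add hIA.le hJB.le).trans_eq ?_
    rw [← ENNReal.coe_add, add_halves]
  have h1 n := ((hasMarginals_graphMeasure hTm hT (κ (φ n))).prod_le hA hmI hB hmJ).trans
    (add_le_add_right herr _)
  have herr' := herr
  rw [symmDiff_comm, symmDiff_comm B] at herr'
  have h2 n := ((hasMarginals_graphMeasure hTm hT (κ (φ n))).prod_le hmI hA hmJ hB).trans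
    (add_le_add_right herr' _)
  refine ⟨_, _, hb ((i, I), (j, J)), ?_, fun n => ⟨h1 n, h2 n⟩⟩
  have hbound : b ((i, I), (j, J)) ≤ μ A + ε := by
    refine le_of_tendsto' (hb _) fun n => (h2 n).trans (add_le_add_left ?_ _)
    rw [← ((hasMarginals_graphMeasure hTm hT (κ (φ n))) A hA).1]
    exact measure_mono (prod_mono_right (subset_univ _))
  exact ne_top_of_le_ne_top (by finiteness) hbound

theorem IsRectangular.tendsto {F : Set (X × X)} (hF : IsRectangular μ F) {ρ : ℕ → Measure (X × X)}
    {σ : Measure (X × X)}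
    (h : ∀ A B : Set X, MeasurableSet A → MeasurableSet B → μ A < ∞ → μ B < ∞ →
      Tendsto (fun j => ρ j (A ×ˢ B)) atTop (𝓝 (σ (A ×ˢ B)))) :
    Tendsto (fun j => ρ j F) atTop (𝓝 (σ F)) := by
  obtain ⟨ι, _, A, B, hAB, hsum⟩ := hF
  simp only [hsum]
  exact tendsto_finsetSum _ fun r _ =>
    h _ _ (hAB r).1 (hAB r).2.1 (hAB r).2.2.1 (hAB r).2.2.2

theorem exists_forall_graphMeasure_le (hTm : Measurable ⇑T.symm)
    (hT : MeasurePreserving ⇑T μ μ) (hrk : IsRankOne μ T)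
    (hpoly : ∀ (n : ℕ → ℤ) (L : Set X → Set X → ℝ≥0∞),
      (∀ A B : Set X, MeasurableSet A → MeasurableSet B → μ A < ∞ → μ B < ∞ →
        Tendsto (fun k => μ ((⇑(T ^ n k)) '' A ∩ B)) atTop (𝓝 (L A B))) →
      ∃ c : ℤ → ℝ≥0, (∑' s : ℤ, (c s : ℝ≥0∞)) ≤ 1 ∧
        ∀ A B : Set X, MeasurableSet A → MeasurableSet B → μ A < ∞ → μ B < ∞ →
          L A B = ∑' s : ℤ, (c s : ℝ≥0∞) * μ ((⇑(T ^ s)) '' A ∩ B))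
    {F : ℕ → Set (X × X)} (hF : Antitone F) (hFm : ∀ n, MeasurableSet (F n))
    (hFr : ∀ n, IsRectangular μ (F n)) {A : Set X} (hA : MeasurableSet A) (hAf : μ A < ∞)
    (hFA : F 0 ⊆ A ×ˢ univ) (hFs : ∀ s, graphMeasure μ T s (⋂ n, F n) = 0)
    {η : ℝ≥0∞} (hη : η ≠ 0) : ∃ n, ∀ k, graphMeasure μ T k (F n) ≤ η := by
  by_contra! hcon
  choose κ hκ using hcon
  obtain ⟨φ, hφ, hlim⟩ := hrk.exists_subseq_tendsto hTm hT κ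
  choose! L hL using hlim
  obtain ⟨c, hc, hLc⟩ := hpoly (κ ∘ φ) L fun A B hA hB hAf hBf =>
    (hL A B hA hB hAf hBf).congr fun j => graphMeasure_prod hTm hT _ hA hB
  let σ : Measure (X × X) := Measure.sum fun s => c s • graphMeasure μ T s
  have hσ {D : Set (X × X)} (hD : MeasurableSet D) :
      σ D = ∑' s, (c s : ℝ≥0∞) * graphMeasure μ T s D := by
    simp only [σ, Measure.sum_apply _ hD, Measure.smul_apply, ENNReal.smul_def, smul_eq_mul]
  have hle n : η ≤ σ (F n) := by
    have ht := (hFr n).tendsto (ρ := fun j => graphMeasure μ T (κ (φ j))) (σ := σ)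
      fun A B hA hB hAf hBf => by
        rw [hσ (hA.prod hB)]
        simp only [graphMeasure_prod hTm hT _ hA hB]
        rw [← hLc A B hA hB hAf hBf]
        exact (hL A B hA hB hAf hBf).congr fun j => graphMeasure_prod hTm hT _ hA hB
    refine ge_of_tendsto ht ?_
    filter_upwards [eventually_ge_atTop n] with j hj
    exact (hκ (φ j)).le.trans (measure_mono (hF (hj.trans (hφ.id_le j))))
  have hfin : σ (F 0) ≠ ∞ := by
    have : σ (A ×ˢ univ) ≤ μ A := by
      rw [hσ (hA.prod .univ)]
      simp only [((hasMarginals_graphMeasure hTm hT _) A hA).1]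
      rw [ENNReal.tsum_mul_right]
      exact mul_le_of_le_one_left' hc
    exact ne_top_of_le_ne_top hAf.ne ((measure_mono hFA).trans this)
  have hzero : σ (⋂ n, F n) = 0 := by
    rw [hσ (.iInter hFm)]
    simp [hFs]
  have ht := tendsto_measure_iInter_atTop (fun n => (hFm n).nullMeasurableSet) hF ⟨0, hfin⟩
  rw [hzero] at ht
  exact hη (le_zero_iff.1 (ge_of_tendsto' ht hle))

end Compactness

section OffGraph

variable {X : Type*} [MeasurableSpace X] {μ : Measure X} {T : Equiv.Perm X}

theorem isRectangular_of_finite {α β : Type} [Finite α] [Finite β] [MeasurableSpace α]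
    [MeasurableSpace β] [MeasurableSingletonClass α] [MeasurableSingletonClass β]
    {f : X → α} {g : X → β} (hf : Measurable f) (hg : Measurable g) (S : α → β → Prop)
    {A : Set X} (hA : MeasurableSet A) (hAf : μ A < ∞) :
    IsRectangular μ {p : X × X | p ∈ A ×ˢ A ∧ S (f p.1) (g p.2)} := by
  classical
  let := Fintype.ofFinite {q : α × β // S q.1 q.2}
  refine ⟨{q : α × β // S q.1 q.2}, inferInstance, fun q => A ∩ f ⁻¹' {q.1.1},
    fun q => A ∩ g ⁻¹' {q.1.2}, fun q => ⟨hA.inter (hf (measurableSet_singleton _)),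
      hA.inter (hg (measurableSet_singleton _)), (measure_mono inter_subset_left).trans_lt hAf,
      (measure_mono inter_subset_left).trans_lt hAf⟩, fun ρ => ?_⟩
  rw [← tsum_fintype (L := .unconditional _), ← measure_iUnion]
  · congr 1
    ext ⟨x, y⟩
    simp only [mem_ofPred_eq, mem_iUnion, mem_prod, mem_inter_iff, mem_preimage, mem_singleton_iff]
    constructor
    · rintro ⟨⟨hx, hy⟩, hS⟩
      exact ⟨⟨(f x, g y), hS⟩, ⟨hx, rfl⟩, hy, rfl⟩
    · rintro ⟨⟨⟨a, b⟩, hS⟩, ⟨hx, rfl⟩, hy, rfl⟩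
      exact ⟨⟨hx, hy⟩, hS⟩
  · intro q q' hqq'
    refine Set.disjoint_left.2 ?_
    rintro ⟨x, y⟩ ⟨⟨_, h1⟩, _, h2⟩ ⟨⟨_, h3⟩, _, h4⟩
    exact hqq' (Subtype.ext (Prod.ext (h1.symm.trans h3) (h2.symm.trans h4)))
  · exact fun q => (hA.inter (hf (measurableSet_singleton _))).prod
      (hA.inter (hg (measurableSet_singleton _)))

/-- The pairs `p` such that the first `m` coordinates of `e ((T ^ s) p.1)` and `e p.2` agree. -/
def agreeSet (T : Equiv.Perm X) (e : X → ℕ → Bool) (s : ℤ) (m : ℕ) : Set (X × X) :=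
  {p | ∀ l < m, e ((T ^ s) p.1) l = e p.2 l}

theorem measurableSet_agreeSet (hTm : Measurable ⇑T.symm) (hT : MeasurePreserving ⇑T μ μ)
    {e : X → ℕ → Bool} (he : Measurable e) (s : ℤ) (m : ℕ) :
    MeasurableSet (agreeSet T e s m) := by
  have h : agreeSet T e s m = ⋂ l ∈ Finset.range m, {p | e ((T ^ s) p.1) l = e p.2 l} := by
    ext; simp [agreeSet]
  rw [h]
  refine Finset.measurableSet_biInter _ fun l _ => measurableSet_eq_fun ?_ ?_
  · exact (measurable_pi_apply l).comp (he.comp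
      ((measurePreserving_zpow hTm hT s).measurable.comp measurable_fst))
  · exact (measurable_pi_apply l).comp (he.comp measurable_snd)

theorem exists_measure_inter_agreeSet_lt (hTm : Measurable ⇑T.symm)
    (hT : MeasurePreserving ⇑T μ μ) {e : X → ℕ → Bool} (he : Measurable e)
    (hinj : Function.Injective e) {s : ℤ} {ν : Measure (X × X)}
    (hν : ν {p | p.2 = (T ^ s) p.1} = 0) {D : Set (X × X)} (hD : MeasurableSet D)
    (hDf : ν D ≠ ∞) {ε : ℝ≥0∞} (hε : 0 < ε) : ∃ m, ν (D ∩ agreeSet T e s m) < ε := by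
  have hanti : Antitone fun m => D ∩ agreeSet T e s m := fun m n hmn p hp =>
    ⟨hp.1, fun l hl => hp.2 l (hl.trans_le hmn)⟩
  have ht := tendsto_measure_iInter_atTop (μ := ν)
    (fun m => (hD.inter (measurableSet_agreeSet hTm hT he s m)).nullMeasurableSet) hanti
    ⟨0, ne_top_of_le_ne_top hDf (measure_mono inter_subset_left)⟩
  have hzero : ν (⋂ m, D ∩ agreeSet T e s m) = 0 := by
    refine measure_mono_null (fun p hp => ?_) hν
    simp only [mem_iInter] at hp
    exact (hinj (funext fun l => (hp (l + 1)).2 l l.lt_succ_self)).symm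
  rw [hzero] at ht
  exact (ht.eventually (gt_mem_nhds hε)).exists

theorem isRectangular_inter_iInter_compl_agreeSet (hTm : Measurable ⇑T.symm)
    (hT : MeasurePreserving ⇑T μ μ) {e : X → ℕ → Bool} (he : Measurable e) (σ : ℕ → ℤ)
    (m : ℕ → ℕ) (n : ℕ) {A : Set X} (hA : MeasurableSet A) (hAf : μ A < ∞) :
    IsRectangular μ ((A ×ˢ A) ∩ ⋂ i < n, (agreeSet T e (σ i) (m i))ᶜ) := by
  have hf : Measurable fun (x : X) (i : Fin n) (l : Fin (m i)) => e ((T ^ σ i) x) l :=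
    measurable_pi_lambda _ fun i => measurable_pi_lambda _ fun l =>
      (measurable_pi_apply _).comp (he.comp (measurePreserving_zpow hTm hT (σ i)).measurable)
  have hg : Measurable fun (x : X) (i : Fin n) (l : Fin (m i)) => e x l :=
    measurable_pi_lambda _ fun i => measurable_pi_lambda _ fun l =>
      (measurable_pi_apply _).comp he
  convert isRectangular_of_finite hf hg (fun a b => ∀ i, a i ≠ b i) hA hAf using 1
  ext p
  simp [agreeSet, funext_iff, Fin.forall_iff]

theorem measure_eq_zero_of_forall_graph [StandardBorelSpace X] [SigmaFinite μ]
    (hTm : Measurable ⇑T.symm) (hT : MeasurePreserving ⇑T μ μ) (hrk : IsRankOne μ T)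
    (hpoly : ∀ (n : ℕ → ℤ) (L : Set X → Set X → ℝ≥0∞),
      (∀ A B : Set X, MeasurableSet A → MeasurableSet B → μ A < ∞ → μ B < ∞ →
        Tendsto (fun k => μ ((⇑(T ^ n k)) '' A ∩ B)) atTop (𝓝 (L A B))) →
      ∃ c : ℤ → ℝ≥0, (∑' s : ℤ, (c s : ℝ≥0∞)) ≤ 1 ∧
        ∀ A B : Set X, MeasurableSet A → MeasurableSet B → μ A < ∞ → μ B < ∞ →
          L A B = ∑' s : ℤ, (c s : ℝ≥0∞) * μ ((⇑(T ^ s)) '' A ∩ B))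
    {ν : Measure (X × X)} (hν : IsSelfJoining μ T ν)
    (hνs : ∀ s : ℤ, ν {p | p.2 = (T ^ s) p.1} = 0) {A : Set X} (hA : MeasurableSet A)
    (hAf : μ A < ∞) : ν (A ×ˢ A) = 0 := by
  obtain ⟨e, he, hinj⟩ := MeasurableSpace.measurable_injection_nat_bool_of_countablySeparated X
  obtain ⟨σ, hσ⟩ := exists_surjective_nat ℤ
  have hfin : ν (A ×ˢ A) ≠ ∞ := by
    refine ne_top_of_le_ne_top hAf.ne ?_
    rw [← (hν.2 A hA hAf).1]
    exact measure_mono (prod_mono_right (subset_univ _))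
  by_contra hne
  lift ν (A ×ˢ A) to ℝ≥0 using hfin with v hv
  have hv0 : 0 < v := pos_iff_ne_zero.2 (by simpa using hne)
  obtain ⟨δ, hδ, hδs⟩ := ENNReal.exists_pos_sum_of_countable
    (ε := ((v / 2 : ℝ≥0) : ℝ≥0∞)) (by simpa using hv0.ne') ℕ
  choose m hm using fun i => exists_measure_inter_agreeSet_lt hTm hT he hinj (hνs (σ i))
    (hA.prod hA) (by simp [← hv]) (ε := δ i) (by exact_mod_cast hδ i)
  let F : ℕ → Set (X × X) := fun n => (A ×ˢ A) ∩ ⋂ i < n, (agreeSet T e (σ i) (m i))ᶜ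
  have hF : Antitone F := fun n n' hn => inter_subset_inter_right _
    (biInter_subset_biInter_left fun i hi => lt_of_lt_of_le hi hn)
  have hFm n : MeasurableSet (F n) := (hA.prod hA).inter
    (.iInter fun i => .iInter fun _ => (measurableSet_agreeSet hTm hT he _ _).compl)
  have hFr n : IsRectangular μ (F n) :=
    isRectangular_inter_iInter_compl_agreeSet hTm hT he σ m n hA hAf
  have hFs s : graphMeasure μ T s (⋂ n, F n) = 0 := by
    rw [graphMeasure, Measure.map_apply (measurable_graph hTm hT s) (.iInter hFm)]
    refine measure_mono_null (t := ∅) (fun x hx => ?_) measure_empty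
    obtain ⟨i, rfl⟩ := hσ s
    have hx' := (mem_iInter.1 hx (i + 1)).2
    simp only [mem_iInter] at hx'
    exact hx' i i.lt_succ_self fun l _ => rfl
  obtain ⟨n, hn⟩ := exists_forall_graphMeasure_le hTm hT hrk hpoly hF hFm hFr hA hAf
    (inter_subset_left.trans (prod_mono_right (subset_univ _))) hFs
    (η := ((v / 8 : ℝ≥0) : ℝ≥0∞)) (by simpa using hv0.ne')
  have h1 := hν.le_two_mul hTm hT hrk (hFr n) hn
  have hcover : A ×ˢ A ⊆ F n ∪ ⋃ i ∈ Finset.range n, (A ×ˢ A) ∩ agreeSet T e (σ i) (m i) := by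
    intro p hp
    by_cases h : ∃ i < n, p ∈ agreeSet T e (σ i) (m i)
    · obtain ⟨i, hi, h⟩ := h
      exact .inr (mem_biUnion (Finset.mem_coe.2 (Finset.mem_range.2 hi)) ⟨hp, h⟩)
    · push Not at h
      exact .inl ⟨hp, by simpa using h⟩
  have h2 : (v : ℝ≥0∞) ≤ 2 * (v / 8 : ℝ≥0) + (v / 2 : ℝ≥0) := by
    rw [hv]
    refine (measure_mono hcover).trans ((measure_union_le _ _).trans (add_le_add h1 ?_))
    refine (measure_biUnion_finset_le _ _).trans (le_trans ?_ hδs.le)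
    exact (Finset.sum_le_sum fun i _ => (hm i).le).trans (ENNReal.sum_le_tsum _)
  have h3 : (v : ℝ) ≤ 2 * (v / 8) + v / 2 := by exact_mod_cast h2
  have : (0 : ℝ) < v := by exact_mod_cast hv0
  linarith

theorem IsSelfJoining.eq_graphMeasure [SigmaFinite μ] (hTm : Measurable ⇑T.symm)
    (hT : MeasurePreserving ⇑T μ μ) {ν : Measure (X × X)} (hν : IsSelfJoining μ T ν) {s : ℤ}
    (hs : ∀ᵐ p ∂ν, p.2 = (T ^ s) p.1) : ν = graphMeasure μ T s := by
  have hfst : ν.map Prod.fst = μ := by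
    ext A hA
    rw [Measure.map_apply measurable_fst hA, ← (hν.hasMarginals A hA).1, prod_univ]
  have hid : id =ᵐ[ν] (fun x => (x, (T ^ s) x)) ∘ Prod.fst :=
    hs.mono fun p hp => Prod.ext rfl hp
  rw [graphMeasure, ← hfst, Measure.map_map (measurable_graph hTm hT s) measurable_fst,
    ← Measure.map_congr hid, Measure.map_id]

end OffGraph

/-- **Corollary to Theorem 1.** If the weak closure of the powers of an ergodic
infinite rank-one transformation `T` is polynomial (every weak limit of powers
is a subconvex combination `Σ_s c_s T^s`), then `T` has minimal self-joinings:
every ergodic self-joining equals a graph measure `Δ^n = μ.map (x ↦ (x, T^n x))`. -/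
theorem minimal_selfJoinings_of_polynomial_weak_closure
    {X : Type*} [MeasurableSpace X] [StandardBorelSpace X]
    (μ : Measure X) [SigmaFinite μ] (hinf : μ Set.univ = ∞)
    (T : Equiv.Perm X) (hTmeas : Measurable (⇑T)) (hTmeas' : Measurable (⇑T.symm))
    (hT : MeasurePreserving ⇑T μ μ)
    (hTerg : ∀ A : Set X, MeasurableSet A → ⇑T ⁻¹' A = A → μ A = 0 ∨ μ Aᶜ = 0)
    (hrk : IsRankOne μ T)
    (hpoly : ∀ (n : ℕ → ℤ) (L : Set X → Set X → ℝ≥0∞),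
      (∀ A B : Set X, MeasurableSet A → MeasurableSet B → μ A < ∞ → μ B < ∞ →
        Tendsto (fun k => μ ((⇑(T ^ n k)) '' A ∩ B)) atTop (𝓝 (L A B))) →
      ∃ c : ℤ → ℝ≥0, (∑' s : ℤ, (c s : ℝ≥0∞)) ≤ 1 ∧
        ∀ A B : Set X, MeasurableSet A → MeasurableSet B → μ A < ∞ → μ B < ∞ →
          L A B = ∑' s : ℤ, (c s : ℝ≥0∞) * μ ((⇑(T ^ s)) '' A ∩ B)) :
    ∀ ν : Measure (X × X), IsSelfJoining μ T ν →
      (∀ C : Set (X × X), MeasurableSet C → Prod.map ⇑T ⇑T ⁻¹' C = C →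
        ν C = 0 ∨ ν Cᶜ = 0) →
      ∃ n : ℤ, ν = Measure.map (fun x => (x, (T ^ n) x)) μ := by
  intro ν hν hνerg
  have hgraph (s : ℤ) : MeasurableSet {p : X × X | p.2 = (T ^ s) p.1} :=
    measurableSet_eq_fun measurable_snd
      ((measurePreserving_zpow hTmeas' hT s).measurable.comp measurable_fst)
  have hinv (s : ℤ) : Prod.map ⇑T ⇑T ⁻¹' {p : X × X | p.2 = (T ^ s) p.1} =
      {p : X × X | p.2 = (T ^ s) p.1} := by
    ext ⟨x, y⟩
    have hcomm : (T ^ s) (T x) = T ((T ^ s) x) := by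
      rw [← Equiv.Perm.mul_apply, ← Equiv.Perm.mul_apply, (Commute.self_zpow T s).eq]
    simp [hcomm]
  by_cases h : ∃ s : ℤ, ν {p : X × X | p.2 = (T ^ s) p.1}ᶜ = 0
  · obtain ⟨s, hs⟩ := h
    exact ⟨s, hν.eq_graphMeasure hTmeas' hT hs⟩
  · push Not at h
    have hzero (s : ℤ) := (hνerg _ (hgraph s) (hinv s)).resolve_right (h s)
    have huniv : (univ : Set (X × X)) = ⋃ n, spanningSets μ n ×ˢ spanningSets μ n := by
      rw [iUnion_prod_of_monotone (monotone_spanningSets μ) (monotone_spanningSets μ),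
        iUnion_spanningSets, univ_prod_univ]
    have hν0 : ν univ = 0 := by
      rw [huniv, measure_iUnion_null_iff]
      exact fun n => measure_eq_zero_of_forall_graph hTmeas' hT hrk hpoly hν hzero
        (measurableSet_spanningSets μ n) (measure_spanningSets_lt_top μ n)
    have htop := (hν.hasMarginals univ .univ).1
    rw [univ_prod_univ, hν0, hinf] at htop
    exact absurd htop ENNReal.zero_ne_top
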